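/- arXiv:1602.04834 — 9 statements merged into one kernel-verified Lean document; each statement's English description precedes it below -/
import Mathlib

section
/- Let f : I ⊆ ℝ → ℝ be four times differentiable on the interior I° of I, with a, b ∈ I°, a < b, and suppose the fourth derivative f⁗ is integrable on [a,b]. Then (1/(b−a)) ∫ₐᵇ f(x) dx + ((b−a)/12)·(f′(b) − f′(a)) − (f(a)+f(b))/2 = ((b−a)⁴/24) · ∫₀¹ (λ(1−λ))² · f⁗(λa + (1−λ)b) dλ. -/
open MeasureTheory intervalIntegral Set

theorem hermite_hadamard_fourth_deriv_identity
    (I : Set ℝ) (hI : I.OrdConnected)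
    (f f1 f2 f3 f4 : ℝ → ℝ) (a b : ℝ)
    (ha : a ∈ interior I) (hb : b ∈ interior I) (hab : a < b)
    (hf1 : ∀ x ∈ interior I, HasDerivAt f (f1 x) x)
    (hf2 : ∀ x ∈ interior I, HasDerivAt f1 (f2 x) x)
    (hf3 : ∀ x ∈ interior I, HasDerivAt f2 (f3 x) x)
    (hf4 : ∀ x ∈ interior I, HasDerivAt f3 (f4 x) x)
    (hint : IntervalIntegrable f4 volume a b) :
    (1 / (b - a)) * ∫ x in a..b, f x + ((b - a) / 12) * (f1 b - f1 a)
        - (f a + f b) / 2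
      = ((b - a) ^ 4 / 24) *
          ∫ t in (0:ℝ)..1, (t * (1 - t)) ^ 2 * f4 (t * a + (1 - t) * b) := by
  have hsub : ∀ x ∈ uIcc a b, x ∈ interior I := by
    intro x hx
    rw [uIcc_of_le hab.le] at hx
    exact hI.interior.out ha hb hx
  have hh : b - a ≠ 0 := sub_ne_zero.mpr hab.ne'
  have hfi : IntervalIntegrable f volume a b :=
    ContinuousOn.intervalIntegrable fun x hx =>
      (hf1 x (hsub x hx)).continuousAt.continuousWithinAt
  -- left-hand side: split off the constants (which are averaged over [a, b])
  have hL : ∫ x in a..b, (f x + ((b - a) / 12) * (f1 b - f1 a) - (f a + f b) / 2)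
      = (∫ x in a..b, f x)
        + (b - a) * (((b - a) / 12) * (f1 b - f1 a) - (f a + f b) / 2) := by
    rw [intervalIntegral.integral_sub (hfi.add intervalIntegrable_const)
      intervalIntegrable_const,
      intervalIntegral.integral_add hfi intervalIntegrable_const,
      intervalIntegral.integral_const, intervalIntegral.integral_const]
    simp only [smul_eq_mul]
    ring
  have hPc : Continuous fun x : ℝ => (x - a) ^ 2 * (b - x) ^ 2 := by fun_prop
  have hPi : IntervalIntegrable (fun x => (x - a) ^ 2 * (b - x) ^ 2 * f4 x) volume a b :=
    hint.continuousOn_mul hPc.continuousOn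
  have hF : ∫ x in a..b, ((x - a) ^ 2 * (b - x) ^ 2 * f4 x - 24 * f x)
      = 2 * (b - a) ^ 2 * (f1 b - f1 a) - 12 * (b - a) * (f a + f b) := by
    rw [intervalIntegral.integral_eq_sub_of_hasDerivAt
      (f := fun x => (x - a) ^ 2 * (x - b) ^ 2 * f3 x
        - (2 * (x - a) * (x - b) ^ 2 + 2 * (x - a) ^ 2 * (x - b)) * f2 x
        + (2 * (x - b) ^ 2 + 8 * (x - a) * (x - b) + 2 * (x - a) ^ 2) * f1 x
        - (12 * (x - a) + 12 * (x - b)) * f x) ?_ (hPi.sub (hfi.const_mul 24))]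
    · ring
    · intro x hx
      have hx' := hsub x hx
      have da : HasDerivAt (fun x : ℝ => x - a) 1 x := (hasDerivAt_id x).sub_const a
      have db : HasDerivAt (fun x : ℝ => x - b) 1 x := (hasDerivAt_id x).sub_const b
      have h := (((((da.pow 2).mul (db.pow 2)).mul (hf4 x hx')).sub
        ((((da.const_mul 2).mul (db.pow 2)).add (((da.pow 2).const_mul 2).mul db)).mul
          (hf3 x hx'))).add
        (((((db.pow 2).const_mul 2).add ((da.const_mul 8).mul db)).add
          ((da.pow 2).const_mul 2)).mul (hf2 x hx'))).sub
        (((da.const_mul 12).add (db.const_mul 12)).mul (hf1 x hx'))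
      refine h.congr_deriv ?_
      simp only [Pi.mul_apply, Pi.add_apply, Pi.pow_apply]
      push_cast
      ring
  rw [intervalIntegral.integral_sub hPi (hfi.const_mul 24),
    intervalIntegral.integral_const_mul] at hF
  have hR : ∫ t in (0:ℝ)..1, (t * (1 - t)) ^ 2 * f4 (t * a + (1 - t) * b)
      = (b - a)⁻¹ * (((b - a) ^ 4)⁻¹ * ∫ x in a..b, (x - a) ^ 2 * (b - x) ^ 2 * f4 x) := by
    have h := intervalIntegral.integral_comp_sub_mul (a := 0) (b := 1)
      (fun x => ((b - a) ^ 4)⁻¹ * ((x - a) ^ 2 * (b - x) ^ 2 * f4 x)) hh b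
    rw [show b - (b - a) * 1 = a by ring, show b - (b - a) * 0 = b by ring, smul_eq_mul] at h
    rw [← intervalIntegral.integral_const_mul, ← h]
    congr 1
    funext t
    rw [show t * a + (1 - t) * b = b - (b - a) * t by ring]
    field_simp
    ring
  rw [hL, hR]
  have hF' : ∫ x in a..b, (x - a) ^ 2 * (b - x) ^ 2 * f4 x
      = 24 * (∫ x in a..b, f x)
        + (2 * (b - a) ^ 2 * (f1 b - f1 a) - 12 * (b - a) * (f a + f b)) := by
    linarith
  rw [hF']
  field_simp
  ring
end

section
/- Let 0 < a < b be real numbers and 0 < α ≤ 1. Then |12·A(a^{α+4}, b^{α+4}) − 12·L_{α+4}(a,b) − (b−a)²·(α+3)(α+4)·L_{α+2}(a,b)| ≤ ((b−a)⁴/60)·(α+1)(α+2)(α+3)(α+4)·max{a^α, b^α}. -/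
noncomputable def arithMean (x y : ℝ) : ℝ := (x + y) / 2

noncomputable def genLogMean (p a b : ℝ) : ℝ :=
  (b ^ (p + 1) - a ^ (p + 1)) / ((p + 1) * (b - a))

theorem nonneg_of_hasDeriv (a b : ℝ) (H h : ℝ → ℝ)
    (hd : ∀ t ∈ Set.Icc a b, HasDerivAt H (h t) t) (h0 : H a = 0)
    (hn : ∀ t ∈ Set.Icc a b, 0 ≤ h t) : ∀ t ∈ Set.Icc a b, 0 ≤ H t := by
  intro t ht
  have hm : MonotoneOn H (Set.Icc a b) := by
    apply monotoneOn_of_deriv_nonneg (convex_Icc a b)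
    · exact fun x hx => (hd x hx).continuousAt.continuousWithinAt
    · exact fun x hx => (hd x (interior_subset hx)).differentiableAt.differentiableWithinAt
    · intro x hx
      rw [(hd x (interior_subset hx)).deriv]
      exact hn x (interior_subset hx)
  have := hm ⟨le_refl a, ht.1.trans ht.2⟩ ht ht.1
  linarith

theorem key_bound (a b α σ K : ℝ) (ha : 0 < a) (hab : a < b) (hα0 : 0 < α)
    (hK : ∀ t ∈ Set.Icc a b, σ * t ^ α ≤ K) :
    0 ≤ σ * (6 * (b - a) * (a ^ (α + 4) + b ^ (α + 4))
        - 12 * (b ^ (α + 5) / (α + 5) - a ^ (α + 5) / (α + 5))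
        - (b - a) ^ 2 * ((α + 4) * b ^ (α + 3) - (α + 4) * a ^ (α + 3)))
      + (α + 1) * (α + 2) * (α + 3) * (α + 4) * K * ((b - a) ^ 5 / 60) := by
  have hp : ∀ p : ℝ, ∀ t ∈ Set.Icc a b, HasDerivAt (fun x : ℝ => x ^ (p + 1)) ((p + 1) * t ^ p) t := by
    intro p t ht
    have := Real.hasDerivAt_rpow_const (x := t) (p := p + 1) (Or.inl (by linarith [ht.1]))
    simpa using this
  have hl : ∀ (n : ℕ) (t : ℝ), HasDerivAt (fun x : ℝ => (x - a) ^ n) (n * (t - a) ^ (n - 1)) t := by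
    intro n t
    have h := HasDerivAt.pow (HasDerivAt.sub_const a (hasDerivAt_id t)) n
    refine HasDerivAt.congr_deriv h ?_
    simp
  have d5 : ∀ t ∈ Set.Icc a b, HasDerivAt (fun x : ℝ => x ^ (α + 5)) ((α + 5) * t ^ (α + 4)) t := by
    intro t ht
    have := hp (α + 4) t ht
    rwa [show α + 4 + 1 = α + 5 by ring] at this
  have d4 : ∀ t ∈ Set.Icc a b, HasDerivAt (fun x : ℝ => x ^ (α + 4)) ((α + 4) * t ^ (α + 3)) t := by
    intro t ht
    have := hp (α + 3) t ht
    rwa [show α + 3 + 1 = α + 4 by ring] at this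
  have d3 : ∀ t ∈ Set.Icc a b, HasDerivAt (fun x : ℝ => x ^ (α + 3)) ((α + 3) * t ^ (α + 2)) t := by
    intro t ht
    have := hp (α + 2) t ht
    rwa [show α + 2 + 1 = α + 3 by ring] at this
  have d2 : ∀ t ∈ Set.Icc a b, HasDerivAt (fun x : ℝ => x ^ (α + 2)) ((α + 2) * t ^ (α + 1)) t := by
    intro t ht
    have := hp (α + 1) t ht
    rwa [show α + 1 + 1 = α + 2 by ring] at this
  have d1 : ∀ t ∈ Set.Icc a b, HasDerivAt (fun x : ℝ => x ^ (α + 1)) ((α + 1) * t ^ α) t :=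
    fun t ht => hp α t ht
  have l1 : ∀ t : ℝ, HasDerivAt (fun x : ℝ => x - a) 1 t := fun t => (hasDerivAt_id t).sub_const a
  set c := (α + 1) * (α + 2) * (α + 3) * (α + 4) with hc
  have hcpos : 0 ≤ c := by positivity
  have s2 : ∀ t ∈ Set.Icc a b, 0 ≤ σ * (-2 * ((α + 4) * t ^ (α + 3) - (α + 4) * a ^ (α + 3))
      + 2 * ((t - a) * ((α + 4) * (α + 3) * t ^ (α + 2)))
      - (t - a) ^ 2 * ((α + 4) * (α + 3) * (α + 2) * t ^ (α + 1))) + c * K * ((t - a) ^ 3 / 3) := by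
    refine nonneg_of_hasDeriv a b _ (fun t => (t - a) ^ 2 * (c * (K - σ * t ^ α))) ?_ ?_ ?_
    · intro t ht
      have := ((((((d3 t ht).const_mul (α + 4)).sub_const ((α + 4) * a ^ (α + 3))).const_mul (-2)).add
        (((l1 t).mul ((d2 t ht).const_mul ((α + 4) * (α + 3)))).const_mul 2)).sub
        ((hl 2 t).mul ((d1 t ht).const_mul ((α + 4) * (α + 3) * (α + 2))))).const_mul σ |>.add
        (((hl 3 t).div_const 3).const_mul (c * K))
      refine HasDerivAt.congr_deriv this ?_
      rw [hc]; push_cast; ring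
    · ring
    · intro t ht
      have := hK t ht
      have : 0 ≤ K - σ * t ^ α := by linarith
      positivity
  have s1 : ∀ t ∈ Set.Icc a b, 0 ≤ σ * (6 * (a ^ (α + 4) - t ^ (α + 4))
      + (t - a) * (4 * ((α + 4) * t ^ (α + 3)) + 2 * ((α + 4) * a ^ (α + 3)))
      - (t - a) ^ 2 * ((α + 4) * (α + 3) * t ^ (α + 2))) + c * K * ((t - a) ^ 4 / 12) := by
    refine nonneg_of_hasDeriv a b _ _ ?_ ?_ s2
    · intro t ht
      have := (((((d4 t ht).const_sub (a ^ (α + 4))).const_mul 6).add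
        ((l1 t).mul ((((d3 t ht).const_mul (α + 4)).const_mul 4).add_const (2 * ((α + 4) * a ^ (α + 3)))))).sub
        ((hl 2 t).mul ((d2 t ht).const_mul ((α + 4) * (α + 3))))).const_mul σ |>.add
        (((hl 4 t).div_const 12).const_mul (c * K))
      refine HasDerivAt.congr_deriv this ?_
      push_cast; ring
    · ring
  refine nonneg_of_hasDeriv a b (fun t => σ * (6 * (t - a) * (a ^ (α + 4) + t ^ (α + 4))
        - 12 * (t ^ (α + 5) / (α + 5) - a ^ (α + 5) / (α + 5))
        - (t - a) ^ 2 * ((α + 4) * t ^ (α + 3) - (α + 4) * a ^ (α + 3)))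
      + c * K * ((t - a) ^ 5 / 60)) _ ?_ ?_ s1 b ⟨hab.le, le_refl b⟩
  · intro t ht
    have := (((((l1 t).const_mul 6).mul ((d4 t ht).const_add (a ^ (α + 4)))).sub
      ((((d5 t ht).div_const (α + 5)).sub_const (a ^ (α + 5) / (α + 5))).const_mul 12)).sub
      ((hl 2 t).mul (((d3 t ht).const_mul (α + 4)).sub_const ((α + 4) * a ^ (α + 3))))).const_mul σ |>.add
      (((hl 5 t).div_const 60).const_mul (c * K))
    refine HasDerivAt.congr_deriv this ?_
    have h5 : (α + 5) * t ^ (α + 4) / (α + 5) = t ^ (α + 4) := by field_simp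
    rw [h5]
    push_cast; ring
  · ring

theorem means_fourth_deriv_quasiconvex (a b α : ℝ)
    (ha : 0 < a) (hab : a < b) (hα0 : 0 < α) (hα1 : α ≤ 1) :
    |12 * arithMean (a ^ (α + 4)) (b ^ (α + 4)) - 12 * genLogMean (α + 4) a b
        - (b - a) ^ 2 * (α + 3) * (α + 4) * genLogMean (α + 2) a b|
      ≤ ((b - a) ^ 4 / 60) * (α + 1) * (α + 2) * (α + 3) * (α + 4) *
          max (a ^ α) (b ^ α) := by
  have hK : ∀ t ∈ Set.Icc a b, t ^ α ≤ max (a ^ α) (b ^ α) := fun t ht =>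
    le_max_of_le_right (Real.rpow_le_rpow (by linarith [ht.1]) ht.2 hα0.le)
  have k1 := key_bound a b α 1 (max (a ^ α) (b ^ α)) ha hab hα0 (by simpa using hK)
  have k2 := key_bound a b α (-1) (max (a ^ α) (b ^ α)) ha hab hα0 (by
    intro t ht
    have h1 := hK t ht
    have h2 : 0 ≤ t ^ α := Real.rpow_nonneg (by linarith [ht.1]) _
    linarith)
  have hh : 0 < b - a := by linarith
  have e : 12 * arithMean (a ^ (α + 4)) (b ^ (α + 4)) - 12 * genLogMean (α + 4) a b
        - (b - a) ^ 2 * (α + 3) * (α + 4) * genLogMean (α + 2) a b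
      = (6 * (b - a) * (a ^ (α + 4) + b ^ (α + 4))
        - 12 * (b ^ (α + 5) / (α + 5) - a ^ (α + 5) / (α + 5))
        - (b - a) ^ 2 * ((α + 4) * b ^ (α + 3) - (α + 4) * a ^ (α + 3))) / (b - a) := by
    unfold arithMean genLogMean
    rw [show α + 4 + 1 = α + 5 by ring, show α + 2 + 1 = α + 3 by ring]
    generalize a ^ (α + 5) = x1
    generalize b ^ (α + 5) = x2
    generalize a ^ (α + 4) = x3
    generalize b ^ (α + 4) = x4
    generalize a ^ (α + 3) = x5
    generalize b ^ (α + 3) = x6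
    have := hh.ne'
    field_simp
    ring
  rw [e, abs_div, abs_of_pos hh, div_le_iff₀ hh, abs_le]
  constructor <;> linarith
end

section
/- Let 0 < a < b be real numbers, 0 < α ≤ 1, p > 1 and q = p/(p−1). Then |12·A(a^{α+4}, b^{α+4}) − 12·L_{α+4}(a,b) − (b−a)²·(α+3)(α+4)·L_{α+2}(a,b)| ≤ ((b−a)⁴/2)·(∫₀¹ (λ(1−λ))^{2p} dλ)^{1/p}·(α+1)(α+2)(α+3)(α+4)·(max{a^{αq}, b^{αq}})^{1/q}, where ∫₀¹ (λ(1−λ))^{2p} dλ = B(2p+1, 2p+1) is the Euler Beta function. -/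
open intervalIntegral

lemma aux_jensen (p : ℝ) (hp : 1 < p) :
    (1 / 30 : ℝ) ≤ (∫ t in (0:ℝ)..1, (t * (1 - t)) ^ (2 * p)) ^ (1 / p) := by
  have hp0 : 0 < p := by linarith
  have key : (1 / 30 : ℝ) ^ p ≤ ∫ t in (0:ℝ)..1, (t * (1 - t)) ^ (2 * p) := by
    have h1 : ∫ t in (0:ℝ)..1, (1 / 30 : ℝ) ^ p * (1 + p * (30 * (t * (1 - t)) ^ 2 - 1))
        = (1 / 30 : ℝ) ^ p := by
      have hd : ∀ t ∈ Set.uIcc (0:ℝ) 1, HasDerivAt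
          (fun t : ℝ => (1 / 30 : ℝ) ^ p * (t + p * (10 * t ^ 3 - 15 * t ^ 4 + 6 * t ^ 5 - t)))
          ((1 / 30 : ℝ) ^ p * (1 + p * (30 * (t * (1 - t)) ^ 2 - 1))) t := by
        intro t _
        have h := ((hasDerivAt_id t).add ((((((hasDerivAt_pow 3 t).const_mul 10).sub
          ((hasDerivAt_pow 4 t).const_mul 15)).add ((hasDerivAt_pow 5 t).const_mul 6)).sub
          (hasDerivAt_id t)).const_mul p)).const_mul ((1 / 30 : ℝ) ^ p)
        refine h.congr_deriv ?_
        norm_num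
        left
        left
        ring
      rw [integral_eq_sub_of_hasDerivAt hd (Continuous.intervalIntegrable (by fun_prop) _ _)]
      ring
    rw [← h1]
    apply intervalIntegral.integral_mono_on (by norm_num)
    · exact Continuous.intervalIntegrable (by fun_prop) _ _
    · apply Continuous.intervalIntegrable
      exact Continuous.rpow_const (by fun_prop) (fun x => Or.inr (by linarith))
    · intro t ht
      have hu : 0 ≤ t * (1 - t) := mul_nonneg ht.1 (by linarith [ht.2])
      have hB := one_add_mul_self_le_rpow_one_add (s := 30 * (t * (1 - t)) ^ 2 - 1)
        (by nlinarith [sq_nonneg (t * (1 - t))]) hp.le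
      have e : (t * (1 - t)) ^ (2 * p) = (1 / 30 : ℝ) ^ p * (1 + (30 * (t * (1 - t)) ^ 2 - 1)) ^ p := by
        rw [← Real.mul_rpow (by norm_num) (by nlinarith [sq_nonneg (t * (1 - t))]),
          Real.rpow_mul hu]
        congr 1
        rw [Real.rpow_two]
        ring
      rw [e]
      exact mul_le_mul_of_nonneg_left hB (by positivity)
  calc (1 / 30 : ℝ) = ((1 / 30 : ℝ) ^ p) ^ (1 / p) := by
        rw [← Real.rpow_mul (by norm_num), mul_one_div_cancel hp0.ne', Real.rpow_one]
    _ ≤ _ := Real.rpow_le_rpow (by positivity) key (by positivity)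

lemma aux_K (a b : ℝ) : ∫ x in a..b, (x - a) ^ 2 * (b - x) ^ 2 = (b - a) ^ 5 / 30 := by
  have hd : ∀ x ∈ Set.uIcc a b, HasDerivAt
      (fun x : ℝ => (b - a) ^ 2 * ((x - a) ^ 3 / 3) - 2 * (b - a) * ((x - a) ^ 4 / 4)
        + (x - a) ^ 5 / 5) ((x - a) ^ 2 * (b - x) ^ 2) x := by
    intro x _
    have h0 := (hasDerivAt_id x).sub_const a
    have h := (((((h0.pow 3).div_const 3).const_mul ((b - a) ^ 2)).sub
      (((h0.pow 4).div_const 4).const_mul (2 * (b - a))))).add ((h0.pow 5).div_const 5)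
    refine h.congr_deriv ?_
    norm_num
    ring
  rw [integral_eq_sub_of_hasDerivAt hd (Continuous.intervalIntegrable (by fun_prop) _ _)]
  ring

lemma aux_H (a b α : ℝ) (ha : 0 < a) (hab : a < b) (hα0 : 0 < α) :
    ∫ x in a..b, (x - a) ^ 2 * (b - x) ^ 2 * ((α + 1) * (α + 2) * (α + 3) * (α + 4) * x ^ α)
     = 2 * (b - a) ^ 2 * ((α + 4) * (b ^ (α + 3) - a ^ (α + 3)))
       - 12 * (b - a) * (a ^ (α + 4) + b ^ (α + 4))
       + 24 * ((b ^ (α + 5) - a ^ (α + 5)) / (α + 5)) := by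
  have hd : ∀ x ∈ Set.uIcc a b, HasDerivAt
      (fun x : ℝ => (x - a) ^ 2 * (x - b) ^ 2 * ((α + 4) * (α + 3) * (α + 2) * x ^ (α + 1))
        - (2 * (x - a) * (x - b) ^ 2 + 2 * (x - a) ^ 2 * (x - b))
            * ((α + 4) * (α + 3) * x ^ (α + 2))
        + (2 * (x - b) ^ 2 + 8 * ((x - a) * (x - b)) + 2 * (x - a) ^ 2) * ((α + 4) * x ^ (α + 3))
        - (12 * (x - a) + 12 * (x - b)) * x ^ (α + 4)
        + 24 / (α + 5) * x ^ (α + 5))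
      ((x - a) ^ 2 * (b - x) ^ 2 * ((α + 1) * (α + 2) * (α + 3) * (α + 4) * x ^ α)) x := by
    intro x hx
    rw [Set.uIcc_of_le hab.le] at hx
    have hx0 : 0 < x := lt_of_lt_of_le ha hx.1
    have A := (hasDerivAt_id x).sub_const a
    have B := (hasDerivAt_id x).sub_const b
    have R : ∀ r s : ℝ, r - 1 = s → HasDerivAt (fun y : ℝ => y ^ r) (r * x ^ s) x := by
      intro r s h
      rw [← h]
      exact Real.hasDerivAt_rpow_const (Or.inl hx0.ne')
    have R1 := R (α + 1) α (by ring)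
    have R2 := R (α + 2) (α + 1) (by ring)
    have R3 := R (α + 3) (α + 2) (by ring)
    have R4 := R (α + 4) (α + 3) (by ring)
    have R5 := R (α + 5) (α + 4) (by ring)
    have h := ((((((A.pow 2).mul (B.pow 2)).mul (R1.const_mul ((α + 4) * (α + 3) * (α + 2)))).sub
      ((((A.const_mul 2).mul (B.pow 2)).add (((A.pow 2).const_mul 2).mul B)).mul
        (R2.const_mul ((α + 4) * (α + 3))))).add
      (((((B.pow 2).const_mul 2).add ((A.mul B).const_mul 8)).add ((A.pow 2).const_mul 2)).mul
        (R3.const_mul (α + 4)))).sub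
      (((A.const_mul 12).add (B.const_mul 12)).mul R4)).add (R5.const_mul (24 / (α + 5)))
    refine h.congr_deriv ?_
    have h5 : α + 5 ≠ 0 := by linarith
    simp
    field_simp
    ring
  rw [integral_eq_sub_of_hasDerivAt hd]
  · ring
  · apply Continuous.intervalIntegrable
    have : Continuous (fun x : ℝ => x ^ α) := Real.continuous_rpow_const hα0.le
    fun_prop

theorem means_fourth_deriv_quasiconvex_holder (a b α p q : ℝ)
    (ha : 0 < a) (hab : a < b) (hα0 : 0 < α) (hα1 : α ≤ 1)
    (hp : 1 < p) (hq : q = p / (p - 1)) :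
    |12 * arithMean (a ^ (α + 4)) (b ^ (α + 4)) - 12 * genLogMean (α + 4) a b
        - (b - a) ^ 2 * (α + 3) * (α + 4) * genLogMean (α + 2) a b|
      ≤ ((b - a) ^ 4 / 2) *
          (∫ t in (0:ℝ)..1, (t * (1 - t)) ^ (2 * p)) ^ (1 / p) *
          (α + 1) * (α + 2) * (α + 3) * (α + 4) *
          (max (a ^ (α * q)) (b ^ (α * q))) ^ (1 / q) := by
  have hp0 : 0 < p := by linarith
  have hq0 : 0 < q := by rw [hq]; exact div_pos hp0 (by linarith)
  have hb : 0 < b := ha.trans hab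
  have hd : 0 < b - a := by linarith
  have hmax : (max (a ^ (α * q)) (b ^ (α * q))) ^ (1 / q) = b ^ α := by
    rw [max_eq_right (Real.rpow_le_rpow ha.le hab.le (by positivity)), ← Real.rpow_mul hb.le]
    congr 1
    field_simp
  rw [hmax]
  have hJ := aux_jensen p hp
  set J := (∫ t in (0:ℝ)..1, (t * (1 - t)) ^ (2 * p)) ^ (1 / p)
  have hH := aux_H a b α ha hab hα0
  set I := ∫ x in a..b, (x - a) ^ 2 * (b - x) ^ 2 *
    ((α + 1) * (α + 2) * (α + 3) * (α + 4) * x ^ α) with hI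
  have hcont : Continuous (fun x : ℝ => x ^ α) := Real.continuous_rpow_const hα0.le
  have hI0 : 0 ≤ I := by
    apply intervalIntegral.integral_nonneg hab.le
    intro x hx
    have : 0 < x := lt_of_lt_of_le ha hx.1
    positivity
  have hI1 : I ≤ (b - a) ^ 5 / 30 * ((α + 1) * (α + 2) * (α + 3) * (α + 4) * b ^ α) := by
    rw [← aux_K, ← intervalIntegral.integral_mul_const]
    apply intervalIntegral.integral_mono_on hab.le
    · exact Continuous.intervalIntegrable (by fun_prop) _ _
    · exact Continuous.intervalIntegrable (by fun_prop) _ _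
    · intro x hx
      have hx0 : 0 < x := lt_of_lt_of_le ha hx.1
      have := Real.rpow_le_rpow hx0.le hx.2 hα0.le
      gcongr
  have hE : 12 * arithMean (a ^ (α + 4)) (b ^ (α + 4)) - 12 * genLogMean (α + 4) a b
        - (b - a) ^ 2 * (α + 3) * (α + 4) * genLogMean (α + 2) a b = -(I / (2 * (b - a))) := by
    rw [hH]
    unfold arithMean genLogMean
    have e1 : α + 4 + 1 = α + 5 := by ring
    have e2 : α + 2 + 1 = α + 3 := by ring
    rw [e1, e2]
    have h5 : α + 5 ≠ 0 := by linarith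
    have h3 : α + 3 ≠ 0 := by linarith
    have hd' := hd.ne'
    field_simp
    ring
  rw [hE, abs_neg, abs_of_nonneg (by positivity), div_le_iff₀ (by positivity)]
  refine hI1.trans ?_
  have hbp : 0 < b ^ α := Real.rpow_pos_of_pos hb α
  calc (b - a) ^ 5 / 30 * ((α + 1) * (α + 2) * (α + 3) * (α + 4) * b ^ α)
      = (1 / 30) * ((b - a) ^ 5 * ((α + 1) * (α + 2) * (α + 3) * (α + 4) * b ^ α)) := by ring
    _ ≤ J * ((b - a) ^ 5 * ((α + 1) * (α + 2) * (α + 3) * (α + 4) * b ^ α)) :=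
        mul_le_mul_of_nonneg_right hJ (by positivity)
    _ = _ := by ring
end

section
/- Let 0 < a < b be real numbers, 0 < α ≤ 1 and q ≥ 1. Then |12·A(a^{α+4}, b^{α+4}) − 12·L_{α+4}(a,b) − (b−a)²·(α+3)(α+4)·L_{α+2}(a,b)| ≤ ((b−a)⁴/60)·(α+1)(α+2)(α+3)(α+4)·(max{a^{αq}, b^{αq}})^{1/q}. -/
theorem aux_mono (a b : ℝ) (g g' : ℝ → ℝ) (h0 : g a = 0)
    (hd : ∀ t ∈ Set.Icc a b, HasDerivAt g (g' t) t) (hn : ∀ t ∈ Set.Icc a b, 0 ≤ g' t) :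
    ∀ t ∈ Set.Icc a b, 0 ≤ g t := by
  intro t ht
  have hm : MonotoneOn g (Set.Icc a b) := by
    apply monotoneOn_of_deriv_nonneg (convex_Icc a b)
    · exact fun x hx => (hd x hx).continuousAt.continuousWithinAt
    · exact fun x hx => (hd x (interior_subset hx)).differentiableAt.differentiableWithinAt
    · intro x hx
      rw [(hd x (interior_subset hx)).deriv]
      exact hn x (interior_subset hx)
  have := hm (Set.left_mem_Icc.2 (ht.1.trans ht.2)) ht ht.1
  rwa [h0] at this

theorem aux_three (a b : ℝ) (g0 g1 g2 g3 : ℝ → ℝ) (h0 : g0 a = 0) (h1 : g1 a = 0) (h2 : g2 a = 0)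
    (d0 : ∀ t ∈ Set.Icc a b, HasDerivAt g0 (g1 t) t)
    (d1 : ∀ t ∈ Set.Icc a b, HasDerivAt g1 (g2 t) t)
    (d2 : ∀ t ∈ Set.Icc a b, HasDerivAt g2 (g3 t) t)
    (hn : ∀ t ∈ Set.Icc a b, 0 ≤ g3 t) : ∀ t ∈ Set.Icc a b, 0 ≤ g0 t :=
  aux_mono a b g0 g1 h0 d0 (aux_mono a b g1 g2 h1 d1 (aux_mono a b g2 g3 h2 d2 hn))

/-- Two-sided Euler-Maclaurin bound. -/
theorem aux_euler (a b C : ℝ) (hab : a ≤ b) (F f0 f1 f2 f3 f4 : ℝ → ℝ)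
    (dF : ∀ t ∈ Set.Icc a b, HasDerivAt F (f0 t) t)
    (d0 : ∀ t ∈ Set.Icc a b, HasDerivAt f0 (f1 t) t)
    (d1 : ∀ t ∈ Set.Icc a b, HasDerivAt f1 (f2 t) t)
    (d2 : ∀ t ∈ Set.Icc a b, HasDerivAt f2 (f3 t) t)
    (d3 : ∀ t ∈ Set.Icc a b, HasDerivAt f3 (f4 t) t)
    (hn : ∀ t ∈ Set.Icc a b, 0 ≤ C + f4 t) :
    0 ≤ C * (b - a) ^ 5 / 60 - (6 * (b - a) * (f0 a + f0 b) - 12 * (F b - F a)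
      - (b - a) ^ 2 * (f1 b - f1 a)) := by
  refine aux_three a b
    (fun t => C * (t - a) ^ 5 / 60 - (6 * (t - a) * (f0 a + f0 t) - 12 * (F t - F a)
      - (t - a) ^ 2 * (f1 t - f1 a)))
    (fun t => C * (t - a) ^ 4 / 12 - (6 * (f0 a - f0 t) + 4 * (t - a) * f1 t
      + 2 * (t - a) * f1 a - (t - a) ^ 2 * f2 t))
    (fun t => C * (t - a) ^ 3 / 3 - (2 * f1 a - 2 * f1 t + 2 * (t - a) * f2 t
      - (t - a) ^ 2 * f3 t))
    (fun t => (t - a) ^ 2 * (C + f4 t)) (by simp) (by simp) (by simp) ?_ ?_ ?_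
    (fun t ht => mul_nonneg (sq_nonneg _) (hn t ht)) b (Set.right_mem_Icc.2 hab)
  all_goals
    intro t ht
    have hi : HasDerivAt (fun t : ℝ => t - a) 1 t := (hasDerivAt_id t).sub_const a
  · refine ((((hi.pow 5).const_mul C).div_const 60).sub
      ((((hi.const_mul 6).mul ((d0 t ht).const_add (f0 a))).sub
      (((dF t ht).sub_const (F a)).const_mul 12)).sub
      ((hi.pow 2).mul ((d1 t ht).sub_const (f1 a))))).congr_deriv ?_
    simp only [Pi.pow_apply]
    push_cast
    ring
  · refine ((((hi.pow 4).const_mul C).div_const 12).sub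
      ((((((d0 t ht).const_sub (f0 a)).const_mul 6).add ((hi.const_mul 4).mul (d1 t ht))).add
      ((hi.const_mul 2).mul_const (f1 a))).sub
      ((hi.pow 2).mul (d2 t ht)))).congr_deriv ?_
    simp only [Pi.pow_apply]
    push_cast
    ring
  · refine ((((hi.pow 3).const_mul C).div_const 3).sub
      (((((d1 t ht).const_mul 2).const_sub (2 * f1 a)).add ((hi.const_mul 2).mul (d2 t ht))).sub
      ((hi.pow 2).mul (d3 t ht)))).congr_deriv ?_
    simp only [Pi.pow_apply]
    push_cast
    ring

theorem aux_rpow (k p r t : ℝ) (ht : 0 < t) (hr : r = p - 1) :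
    HasDerivAt (fun x : ℝ => k * x ^ p) (k * p * t ^ r) t := by
  subst hr
  rw [mul_assoc]
  exact (Real.hasDerivAt_rpow_const (Or.inl ht.ne')).const_mul k

theorem means_fourth_deriv_quasiconvex_power_mean (a b α q : ℝ)
    (ha : 0 < a) (hab : a < b) (hα0 : 0 < α) (hα1 : α ≤ 1) (hq : 1 ≤ q) :
    |12 * arithMean (a ^ (α + 4)) (b ^ (α + 4)) - 12 * genLogMean (α + 4) a b
        - (b - a) ^ 2 * (α + 3) * (α + 4) * genLogMean (α + 2) a b|
      ≤ ((b - a) ^ 4 / 60) * (α + 1) * (α + 2) * (α + 3) * (α + 4) *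
          (max (a ^ (α * q)) (b ^ (α * q))) ^ (1 / q) := by
  have hb : 0 < b := ha.trans hab
  have hq0 : 0 < q := by linarith
  have hmax : (max (a ^ (α * q)) (b ^ (α * q))) ^ (1 / q) = b ^ α := by
    rw [max_eq_right (Real.rpow_le_rpow ha.le hab.le (by positivity)), ← Real.rpow_mul hb.le]
    congr 1
    field_simp
  rw [hmax]
  have key : ∀ s C : ℝ, (∀ t ∈ Set.Icc a b,
      0 ≤ C + s * (α + 4) * (α + 3) * (α + 2) * (α + 1) * t ^ α) → _ := fun s C hn =>
    aux_euler a b C hab.le (fun t => s / (α + 5) * t ^ (α + 5)) (fun t => s * t ^ (α + 4))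
      (fun t => s * (α + 4) * t ^ (α + 3)) (fun t => s * (α + 4) * (α + 3) * t ^ (α + 2))
      (fun t => s * (α + 4) * (α + 3) * (α + 2) * t ^ (α + 1))
      (fun t => s * (α + 4) * (α + 3) * (α + 2) * (α + 1) * t ^ α)
      (fun t ht => (aux_rpow _ _ (α + 4) t (ha.trans_le ht.1) (by ring)).congr_deriv
        (by field_simp))
      (fun t ht => aux_rpow _ _ _ t (ha.trans_le ht.1) (by ring))
      (fun t ht => aux_rpow _ _ _ t (ha.trans_le ht.1) (by ring))
      (fun t ht => aux_rpow _ _ _ t (ha.trans_le ht.1) (by ring))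
      (fun t ht => aux_rpow _ _ _ t (ha.trans_le ht.1) (by ring)) hn
  have k1 := key 1 0 (fun t ht => by
    have := ha.trans_le ht.1
    positivity)
  have k2 := key (-1) ((α + 4) * (α + 3) * (α + 2) * (α + 1) * b ^ α) (fun t ht => by
    have h1 : t ^ α ≤ b ^ α := Real.rpow_le_rpow (ha.le.trans ht.1) ht.2 hα0.le
    have h2 : 0 ≤ (α + 4) * (α + 3) * (α + 2) * (α + 1) := by positivity
    nlinarith [mul_le_mul_of_nonneg_left h1 h2])
  have hh : 0 < b - a := sub_pos.2 hab
  set X := 12 * arithMean (a ^ (α + 4)) (b ^ (α + 4)) - 12 * genLogMean (α + 4) a b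
        - (b - a) ^ 2 * (α + 3) * (α + 4) * genLogMean (α + 2) a b with hX
  have hXe : (b - a) * X = 6 * (b - a) * (a ^ (α + 4) + b ^ (α + 4))
      - 12 * (b ^ (α + 5) - a ^ (α + 5)) / (α + 5)
      - (b - a) ^ 2 * (α + 4) * (b ^ (α + 3) - a ^ (α + 3)) := by
    rw [hX]
    unfold arithMean genLogMean
    rw [show α + 4 + 1 = α + 5 by ring, show α + 2 + 1 = α + 3 by ring]
    field_simp
    ring
  have k1' : 0 ≤ (b - a) * (-X) := by
    rw [mul_neg, hXe]
    refine k1.trans_eq ?_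
    ring
  have k2' : 0 ≤ (b - a) * (((b - a) ^ 4 / 60) * (α + 1) * (α + 2) * (α + 3) * (α + 4) * b ^ α
      + X) := by
    rw [mul_add, hXe]
    refine k2.trans_eq ?_
    ring
  have l1 := nonneg_of_mul_nonneg_right k1' hh
  have l2 := nonneg_of_mul_nonneg_right k2' hh
  rw [abs_le]
  constructor
  · linarith
  · have : 0 ≤ ((b - a) ^ 4 / 60) * (α + 1) * (α + 2) * (α + 3) * (α + 4) * b ^ α := by positivity
    linarith
end

section
/- Let 0 < a < b be real numbers and 0 < α ≤ 1. Then |24·A(a,b)^{α+4} − 24·L_{α+4}(a,b) + (b−a)²·(α+3)(α+4)·L_{α+2}(a,b)| ≤ ((b−a)³/8)·(α+2)(α+3)(α+4)·max{a^{α+1}, b^{α+1}}. -/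
theorem aux_step (u u' : ℝ → ℝ) (h c : ℝ) (n : ℕ) (h0 : u 0 = 0)
    (hd : ∀ t ∈ Set.Icc 0 h, HasDerivAt u (u' t) t)
    (hb : ∀ t ∈ Set.Icc 0 h, 0 ≤ u' t ∧ u' t ≤ c * (n + 1) * t ^ n) :
    ∀ t ∈ Set.Icc 0 h, 0 ≤ u t ∧ u t ≤ c * t ^ (n + 1) := by
  intro t ht
  have hz : (0 : ℝ) ∈ Set.Icc 0 h := ⟨le_rfl, ht.1.trans ht.2⟩
  have mon : ∀ v v' : ℝ → ℝ, (∀ t ∈ Set.Icc 0 h, HasDerivAt v (v' t) t) →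
      (∀ t ∈ Set.Icc 0 h, 0 ≤ v' t) → v 0 ≤ v t := by
    intro v v' hv hv'
    have : MonotoneOn v (Set.Icc 0 h) := by
      apply monotoneOn_of_deriv_nonneg (convex_Icc 0 h)
      · exact fun x hx => (hv x hx).continuousAt.continuousWithinAt
      · exact fun x hx => (hv x (interior_subset hx)).differentiableAt.differentiableWithinAt
      · intro x hx
        rw [(hv x (interior_subset hx)).deriv]
        exact hv' x (interior_subset hx)
    exact this hz ht ht.1
  constructor
  · have := mon u u' hd (fun t ht => (hb t ht).1)
    linarith
  · have := mon (fun t => c * t ^ (n + 1) - u t) (fun t => c * (n + 1) * t ^ n - u' t)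
      (fun x hx => by
        refine HasDerivAt.sub ?_ (hd x hx)
        have := (hasDerivAt_pow (n + 1) x).const_mul c
        refine this.congr_deriv ?_
        push_cast
        ring)
      (fun x hx => by linarith [(hb x hx).2])
    simp [h0] at this
    linarith

theorem aux_main (G g0 g1 g2 g3 : ℝ → ℝ) (m h M : ℝ) (hh : 0 ≤ h)
    (dG : ∀ x ∈ Set.Icc (m - h) (m + h), HasDerivAt G (g0 x) x)
    (d0 : ∀ x ∈ Set.Icc (m - h) (m + h), HasDerivAt g0 (g1 x) x)
    (d1 : ∀ x ∈ Set.Icc (m - h) (m + h), HasDerivAt g1 (g2 x) x)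
    (d2 : ∀ x ∈ Set.Icc (m - h) (m + h), HasDerivAt g2 (g3 x) x)
    (h3 : ∀ t ∈ Set.Icc 0 h, 0 ≤ g3 (m + t) - g3 (m - t) ∧ g3 (m + t) - g3 (m - t) ≤ M) :
    0 ≤ 48 * h * g0 m - 24 * (G (m + h) - G (m - h)) + 4 * h ^ 2 * (g1 (m + h) - g1 (m - h)) ∧
    48 * h * g0 m - 24 * (G (m + h) - G (m - h)) + 4 * h ^ 2 * (g1 (m + h) - g1 (m - h))
      ≤ M * h ^ 4 := by
  have P : ∀ f f' : ℝ → ℝ, (∀ x ∈ Set.Icc (m - h) (m + h), HasDerivAt f (f' x) x) →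
      ∀ t ∈ Set.Icc 0 h, HasDerivAt (fun t => f (m + t)) (f' (m + t)) t := by
    intro f f' hf t ht
    exact (hf (m + t) ⟨by linarith [ht.1], by linarith [ht.2]⟩).comp_const_add m t
  have N : ∀ f f' : ℝ → ℝ, (∀ x ∈ Set.Icc (m - h) (m + h), HasDerivAt f (f' x) x) →
      ∀ t ∈ Set.Icc 0 h, HasDerivAt (fun t => f (m - t)) (-f' (m - t)) t := by
    intro f f' hf t ht
    exact (hf (m - t) ⟨by linarith [ht.2], by linarith [ht.1]⟩).comp_const_sub m t
  have s1 := aux_step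
    (fun t => 16 * (t * (g2 (m + t) + g2 (m - t)) - (g1 (m + t) - g1 (m - t))))
    (fun t => 16 * (t * (g3 (m + t) - g3 (m - t)))) h (8 * M) 1 (by simp)
    (fun t ht => by
      have := (((hasDerivAt_id' t).mul ((P _ _ d2 t ht).add (N _ _ d2 t ht))).sub
        ((P _ _ d1 t ht).sub (N _ _ d1 t ht))).const_mul 16
      refine this.congr_deriv ?_
      simp only [Pi.add_apply]
      ring)
    (fun t ht => by
      obtain ⟨q1, q2⟩ := h3 t ht
      have := mul_le_mul_of_nonneg_left q2 ht.1
      have := mul_nonneg ht.1 q1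
      constructor
      · linarith
      · norm_num; linarith)
  have s2 := aux_step
    (fun t => 48 * g0 m - 24 * (g0 (m + t) + g0 (m - t)) + 8 * (t * (g1 (m + t) - g1 (m - t)))
      + 4 * (t ^ 2 * (g2 (m + t) + g2 (m - t))))
    (fun t => 16 * (t * (g2 (m + t) + g2 (m - t)) - (g1 (m + t) - g1 (m - t)))
      + 4 * (t ^ 2 * (g3 (m + t) - g3 (m - t)))) h (4 * M) 2 (by simp; ring)
    (fun t ht => by
      have := (((((P _ _ d0 t ht).add (N _ _ d0 t ht)).const_mul 24).const_sub (48 * g0 m)).add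
        (((hasDerivAt_id' t).mul ((P _ _ d1 t ht).sub (N _ _ d1 t ht))).const_mul 8)).add
        (((hasDerivAt_pow 2 t).mul ((P _ _ d2 t ht).add (N _ _ d2 t ht))).const_mul 4)
      refine this.congr_deriv ?_
      simp only [Pi.add_apply, Pi.sub_apply]
      push_cast
      ring)
    (fun t ht => by
      obtain ⟨q1, q2⟩ := h3 t ht
      obtain ⟨r1, r2⟩ := s1 t ht
      have := mul_le_mul_of_nonneg_left q2 (sq_nonneg t)
      have := mul_nonneg (sq_nonneg t) q1
      norm_num at r1 r2 ⊢
      constructor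
      · linarith
      · linarith)
  have s3 := aux_step
    (fun t => 48 * t * g0 m - 24 * (G (m + t) - G (m - t)) + 4 * (t ^ 2 * (g1 (m + t) - g1 (m - t))))
    (fun t => 48 * g0 m - 24 * (g0 (m + t) + g0 (m - t)) + 8 * (t * (g1 (m + t) - g1 (m - t)))
      + 4 * (t ^ 2 * (g2 (m + t) + g2 (m - t)))) h M 3 (by simp)
    (fun t ht => by
      have := ((((hasDerivAt_id' t).const_mul 48).mul_const (g0 m)).sub
        (((P _ _ dG t ht).sub (N _ _ dG t ht)).const_mul 24)).add
        (((hasDerivAt_pow 2 t).mul ((P _ _ d1 t ht).sub (N _ _ d1 t ht))).const_mul 4)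
      refine this.congr_deriv ?_
      simp only [Pi.sub_apply]
      push_cast
      ring)
    (fun t ht => by
      obtain ⟨r1, r2⟩ := s2 t ht
      norm_num at r1 r2 ⊢
      constructor
      · linarith
      · linarith)
  obtain ⟨r1, r2⟩ := s3 h ⟨hh, le_rfl⟩
  norm_num at r1 r2
  constructor <;> linarith

theorem means_midpoint_third_deriv_quasiconvex (a b α : ℝ)
    (ha : 0 < a) (hab : a < b) (hα0 : 0 < α) (hα1 : α ≤ 1) :
    |24 * arithMean a b ^ (α + 4) - 24 * genLogMean (α + 4) a b
        + (b - a) ^ 2 * (α + 3) * (α + 4) * genLogMean (α + 2) a b|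
      ≤ ((b - a) ^ 3 / 8) * (α + 2) * (α + 3) * (α + 4) *
          max (a ^ (α + 1)) (b ^ (α + 1)) := by
  have hba : 0 < b - a := sub_pos.2 hab
  have e1 : (a + b) / 2 - (b - a) / 2 = a := by ring
  have e2 : (a + b) / 2 + (b - a) / 2 = b := by ring
  have D : ∀ c s r : ℝ, r = s - 1 → ∀ x ∈ Set.Icc ((a + b) / 2 - (b - a) / 2)
      ((a + b) / 2 + (b - a) / 2),
      HasDerivAt (fun x : ℝ => c * x ^ s) ((c * s) * x ^ r) x := by
    intro c s r hr x hx
    rw [e1] at hx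
    have hx0 : x ≠ 0 := by linarith [hx.1]
    have := (Real.hasDerivAt_rpow_const (p := s) (Or.inl hx0)).const_mul c
    rw [hr, mul_assoc]
    exact this
  have hC : 0 < (α + 4) * (α + 3) * (α + 2) := by positivity
  have key := aux_main (fun x => 1 / (α + 5) * x ^ (α + 5)) (fun x => x ^ (α + 4))
    (fun x => (α + 4) * x ^ (α + 3))
    (fun x => ((α + 4) * (α + 3)) * x ^ (α + 2))
    (fun x => ((α + 4) * (α + 3) * (α + 2)) * x ^ (α + 1))
    ((a + b) / 2) ((b - a) / 2) ((α + 4) * (α + 3) * (α + 2) * b ^ (α + 1)) (by linarith)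
    (fun x hx => by
      have := D (1 / (α + 5)) (α + 5) (α + 4) (by ring) x hx
      refine this.congr_deriv ?_
      field_simp)
    (fun x hx => by
      have := D 1 (α + 4) (α + 3) (by ring) x hx
      simpa using this)
    (fun x hx => D _ _ _ (by ring) x hx)
    (fun x hx => D _ _ _ (by ring) x hx)
    (fun t ht => by
      obtain ⟨t0, t1⟩ := ht
      have p1 : ((a + b) / 2 - t) ^ (α + 1) ≤ ((a + b) / 2 + t) ^ (α + 1) :=
        Real.rpow_le_rpow (by linarith) (by linarith) (by linarith)
      have p2 : ((a + b) / 2 + t) ^ (α + 1) ≤ b ^ (α + 1) :=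
        Real.rpow_le_rpow (by linarith) (by linarith) (by linarith)
      have p3 : 0 ≤ ((a + b) / 2 - t) ^ (α + 1) :=
        Real.rpow_nonneg (by linarith) _
      rw [← mul_sub]
      exact ⟨mul_nonneg hC.le (by linarith), mul_le_mul_of_nonneg_left (by linarith) hC.le⟩)
  simp only [e1, e2] at key
  have hm : max (a ^ (α + 1)) (b ^ (α + 1)) = b ^ (α + 1) :=
    max_eq_right (Real.rpow_le_rpow ha.le hab.le (by linarith))
  rw [hm]
  unfold arithMean genLogMean
  have x1 : α + 4 + 1 = α + 5 := by ring
  have x2 : α + 2 + 1 = α + 3 := by ring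
  rw [x1, x2]
  set E := 24 * ((a + b) / 2) ^ (α + 4) - 24 * ((b ^ (α + 5) - a ^ (α + 5)) / ((α + 5) * (b - a)))
        + (b - a) ^ 2 * (α + 3) * (α + 4) * ((b ^ (α + 3) - a ^ (α + 3)) / ((α + 3) * (b - a)))
    with hE
  have hEq : 48 * ((b - a) / 2) * ((a + b) / 2) ^ (α + 4) -
      24 * (1 / (α + 5) * b ^ (α + 5) - 1 / (α + 5) * a ^ (α + 5)) +
      4 * ((b - a) / 2) ^ 2 * ((α + 4) * b ^ (α + 3) - (α + 4) * a ^ (α + 3)) = (b - a) * E := by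
    rw [hE]
    generalize ((a + b) / 2) ^ (α + 4) = z
    have : α + 5 ≠ 0 := by positivity
    have : α + 3 ≠ 0 := by positivity
    have : b - a ≠ 0 := hba.ne'
    field_simp
    ring
  rw [hEq] at key
  obtain ⟨k1, k2⟩ := key
  have hE0 : 0 ≤ E := nonneg_of_mul_nonneg_right k1 hba
  rw [abs_of_nonneg hE0]
  have hb : 0 ≤ b ^ (α + 1) := Real.rpow_nonneg (by linarith) _
  have hQ : 0 ≤ (b - a) ^ 4 * ((α + 4) * (α + 3) * (α + 2) * b ^ (α + 1)) := by positivity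
  refine le_of_mul_le_mul_left (k2.trans ?_) hba
  nlinarith [hQ]
end

section
/- Let 0 < a < b be real numbers, 0 < α ≤ 1 and q ≥ 1. Then |24·A(a,b)^{α+4} − 24·L_{α+4}(a,b) + (b−a)²·(α+3)(α+4)·L_{α+2}(a,b)| ≤ ((b−a)³/8)·(α+2)(α+3)(α+4)·(max{a^{(α+1)q}, b^{(α+1)q}})^{1/q}. -/
theorem aux_bound (g g' : ℝ → ℝ) (H C : ℝ) (n : ℕ) (h0 : g 0 = 0)
    (hd : ∀ t ∈ Set.Icc 0 H, HasDerivAt g (g' t) t)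
    (hb : ∀ t ∈ Set.Icc 0 H, 0 ≤ g' t ∧ g' t ≤ C * ((n + 1 : ℕ) * t ^ n)) :
    ∀ t ∈ Set.Icc 0 H, 0 ≤ g t ∧ g t ≤ C * t ^ (n + 1) := by
  intro t ht
  have hz : (0 : ℝ) ∈ Set.Icc 0 H := ⟨le_rfl, ht.1.trans ht.2⟩
  have m1 : MonotoneOn g (Set.Icc 0 H) := by
    apply monotoneOn_of_hasDerivWithinAt_nonneg (f' := g') (convex_Icc 0 H)
    · exact fun x hx => (hd x hx).continuousAt.continuousWithinAt
    · exact fun x hx => (hd x (interior_subset hx)).hasDerivWithinAt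
    · exact fun x hx => (hb x (interior_subset hx)).1
  have hd2 : ∀ x ∈ Set.Icc 0 H,
      HasDerivAt (fun x => C * x ^ (n + 1) - g x) (C * ((n + 1 : ℕ) * x ^ n) - g' x) x := by
    intro x hx
    exact ((hasDerivAt_pow (n + 1) x).const_mul C).sub (hd x hx)
  have m2 : MonotoneOn (fun x => C * x ^ (n + 1) - g x) (Set.Icc 0 H) := by
    apply monotoneOn_of_hasDerivWithinAt_nonneg
      (f' := fun x => C * ((n + 1 : ℕ) * x ^ n) - g' x) (convex_Icc 0 H)
    · exact fun x hx => (hd2 x hx).continuousAt.continuousWithinAt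
    · exact fun x hx => (hd2 x (interior_subset hx)).hasDerivWithinAt
    · exact fun x hx => sub_nonneg.2 (hb x (interior_subset hx)).2
  have a1 := m1 hz ht ht.1
  have a2 := m2 hz ht ht.1
  simp [h0] at a1 a2
  exact ⟨a1, a2⟩

theorem aux_plus (m r s t : ℝ) (hs : s = r - 1) (h : 0 < m + t) :
    HasDerivAt (fun t => (m + t) ^ r) (r * (m + t) ^ s) t := by
  subst hs
  have := ((hasDerivAt_id t).const_add m).rpow_const (p := r) (Or.inl h.ne')
  simpa using this

theorem aux_minus (m r s t : ℝ) (hs : s = r - 1) (h : 0 < m - t) :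
    HasDerivAt (fun t => (m - t) ^ r) (-(r * (m - t) ^ s)) t := by
  subst hs
  have := ((hasDerivAt_id t).const_sub m).rpow_const (p := r) (Or.inl h.ne')
  simpa using this

theorem aux_main_s13 (m H α : ℝ) (hH : 0 < H) (hm : 0 < m - H) (hα : 0 < α) :
    0 ≤ 48 * H * m ^ (α + 4) - 24 * (((m + H) ^ (α + 5) - (m - H) ^ (α + 5)) / (α + 5))
      + 4 * H ^ 2 * ((α + 4) * ((m + H) ^ (α + 3) - (m - H) ^ (α + 3))) ∧
    48 * H * m ^ (α + 4) - 24 * (((m + H) ^ (α + 5) - (m - H) ^ (α + 5)) / (α + 5))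
      + 4 * H ^ 2 * ((α + 4) * ((m + H) ^ (α + 3) - (m - H) ^ (α + 3))) ≤
    ((α + 4) * (α + 3) * (α + 2) * (m + H) ^ (α + 1)) * H ^ 4 := by
  set M := (α + 4) * (α + 3) * (α + 2) * (m + H) ^ (α + 1) with hM
  have pp : ∀ t ∈ Set.Icc 0 H, 0 < m + t := fun t ht => by linarith [ht.1, ht.2]
  have pm : ∀ t ∈ Set.Icc 0 H, 0 < m - t := fun t ht => by linarith [ht.1, ht.2]
  have D : ∀ t ∈ Set.Icc 0 H, 0 ≤ (α + 4) * (α + 3) * (α + 2) * ((m + t) ^ (α + 1) - (m - t) ^ (α + 1)) ∧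
      (α + 4) * (α + 3) * (α + 2) * ((m + t) ^ (α + 1) - (m - t) ^ (α + 1)) ≤ M := by
    intro t ht
    have e1 : (m - t) ^ (α + 1) ≤ (m + t) ^ (α + 1) :=
      Real.rpow_le_rpow (pm t ht).le (by linarith [ht.1]) (by linarith)
    have e2 : (m + t) ^ (α + 1) ≤ (m + H) ^ (α + 1) :=
      Real.rpow_le_rpow (pp t ht).le (by linarith [ht.2]) (by linarith)
    have e3 : 0 ≤ (m - t) ^ (α + 1) := Real.rpow_nonneg (pm t ht).le _
    have e4 : 0 ≤ (α + 4) * (α + 3) * (α + 2) := by positivity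
    exact ⟨mul_nonneg e4 (by linarith), mul_le_mul_of_nonneg_left (by linarith) e4⟩
  have s1 := aux_bound
    (fun t => t * ((α + 4) * (α + 3) * ((m + t) ^ (α + 2) + (m - t) ^ (α + 2)))
      - (α + 4) * ((m + t) ^ (α + 3) - (m - t) ^ (α + 3)))
    (fun t => t * ((α + 4) * (α + 3) * (α + 2) * ((m + t) ^ (α + 1) - (m - t) ^ (α + 1))))
    H (M / 2) 1 (by simp)
    (by
      intro t ht
      have hp := pp t ht
      have hm := pm t ht
      have := ((hasDerivAt_id t).mul (((aux_plus m (α + 2) (α + 1) t (by ring) hp).add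
        (aux_minus m (α + 2) (α + 1) t (by ring) hm)).const_mul ((α + 4) * (α + 3)))).sub
        (((aux_plus m (α + 3) (α + 2) t (by ring) hp).sub
        (aux_minus m (α + 3) (α + 2) t (by ring) hm)).const_mul (α + 4))
      refine this.congr_deriv ?_
      simp only [id, Pi.add_apply, Pi.sub_apply]
      ring)
    (by
      intro t ht
      obtain ⟨d1, d2⟩ := D t ht
      refine ⟨mul_nonneg ht.1 d1, ?_⟩
      have := mul_le_mul_of_nonneg_left d2 ht.1
      push_cast
      linarith)
  have s2 := aux_bound
    (fun t => 48 * m ^ (α + 4) - 24 * ((m + t) ^ (α + 4) + (m - t) ^ (α + 4))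
      + 8 * t * ((α + 4) * ((m + t) ^ (α + 3) - (m - t) ^ (α + 3)))
      + 4 * t ^ 2 * ((α + 4) * (α + 3) * ((m + t) ^ (α + 2) + (m - t) ^ (α + 2))))
    (fun t => 16 * (t * ((α + 4) * (α + 3) * ((m + t) ^ (α + 2) + (m - t) ^ (α + 2)))
      - (α + 4) * ((m + t) ^ (α + 3) - (m - t) ^ (α + 3))) + 4 * t ^ 2 *
      ((α + 4) * (α + 3) * (α + 2) * ((m + t) ^ (α + 1) - (m - t) ^ (α + 1))))
    H (4 * M) 2 (by simp; ring)
    (by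
      intro t ht
      have hp := pp t ht
      have hm := pm t ht
      have := (((((aux_plus m (α + 4) (α + 3) t (by ring) hp).add
        (aux_minus m (α + 4) (α + 3) t (by ring) hm)).const_mul 24).const_sub
          (48 * m ^ (α + 4))).add
        (((hasDerivAt_id t).const_mul 8).mul (((aux_plus m (α + 3) (α + 2) t (by ring) hp).sub
        (aux_minus m (α + 3) (α + 2) t (by ring) hm)).const_mul (α + 4)))).add
        (((hasDerivAt_pow 2 t).const_mul 4).mul
        (((aux_plus m (α + 2) (α + 1) t (by ring) hp).add
        (aux_minus m (α + 2) (α + 1) t (by ring) hm)).const_mul ((α + 4) * (α + 3))))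
      refine this.congr_deriv ?_
      simp only [id, Pi.add_apply, Pi.sub_apply]
      push_cast
      ring)
    (by
      intro t ht
      obtain ⟨d1, d2⟩ := D t ht
      obtain ⟨c1, c2⟩ := s1 t ht
      have k1 := mul_nonneg (sq_nonneg t) d1
      have k2 := mul_le_mul_of_nonneg_left d2 (sq_nonneg t)
      norm_num at c1 c2 ⊢
      constructor <;> linarith)
  have s3 := aux_bound
    (fun t => 48 * t * m ^ (α + 4) - 24 * (((m + t) ^ (α + 5) - (m - t) ^ (α + 5)) / (α + 5))
      + 4 * t ^ 2 * ((α + 4) * ((m + t) ^ (α + 3) - (m - t) ^ (α + 3))))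
    (fun t => 48 * m ^ (α + 4) - 24 * ((m + t) ^ (α + 4) + (m - t) ^ (α + 4))
      + 8 * t * ((α + 4) * ((m + t) ^ (α + 3) - (m - t) ^ (α + 3)))
      + 4 * t ^ 2 * ((α + 4) * (α + 3) * ((m + t) ^ (α + 2) + (m - t) ^ (α + 2))))
    H M 3 (by simp)
    (by
      intro t ht
      have hp := pp t ht
      have hm := pm t ht
      have := ((((hasDerivAt_id t).const_mul 48).mul_const (m ^ (α + 4))).sub
        ((((aux_plus m (α + 5) (α + 4) t (by ring) hp).sub
        (aux_minus m (α + 5) (α + 4) t (by ring) hm)).div_const (α + 5)).const_mul 24)).add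
        (((hasDerivAt_pow 2 t).const_mul 4).mul
        (((aux_plus m (α + 3) (α + 2) t (by ring) hp).sub
        (aux_minus m (α + 3) (α + 2) t (by ring) hm)).const_mul (α + 4)))
      refine this.congr_deriv ?_
      simp only [id, Pi.add_apply, Pi.sub_apply]
      have : α + 5 ≠ 0 := by positivity
      push_cast
      field_simp
      ring)
    (by
      intro t ht
      obtain ⟨c1, c2⟩ := s2 t ht
      refine ⟨c1, ?_⟩
      norm_num at c2 ⊢
      linarith)
  exact s3 H ⟨hH.le, le_rfl⟩

theorem means_midpoint_third_deriv_quasiconvex_power_mean (a b α q : ℝ)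
    (ha : 0 < a) (hab : a < b) (hα0 : 0 < α) (hα1 : α ≤ 1) (hq : 1 ≤ q) :
    |24 * arithMean a b ^ (α + 4) - 24 * genLogMean (α + 4) a b
        + (b - a) ^ 2 * (α + 3) * (α + 4) * genLogMean (α + 2) a b|
      ≤ ((b - a) ^ 3 / 8) * (α + 2) * (α + 3) * (α + 4) *
          (max (a ^ ((α + 1) * q)) (b ^ ((α + 1) * q))) ^ (1 / q) := by
  have hb : 0 < b := ha.trans hab
  have hmax : (max (a ^ ((α + 1) * q)) (b ^ ((α + 1) * q))) ^ (1 / q) = b ^ (α + 1) := by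
    rw [max_eq_right (Real.rpow_le_rpow ha.le hab.le (by positivity)), ← Real.rpow_mul hb.le]
    congr 1
    field_simp
  rw [hmax]
  have key := aux_main_s13 ((a + b) / 2) ((b - a) / 2) α (by linarith) (by linarith) hα0
  rw [show (a + b) / 2 + (b - a) / 2 = b by ring, show (a + b) / 2 - (b - a) / 2 = a by ring] at key
  have hd : 0 < b - a := by linarith
  unfold arithMean genLogMean
  rw [show α + 4 + 1 = α + 5 by ring, show α + 2 + 1 = α + 3 by ring]
  set E := 24 * ((a + b) / 2) ^ (α + 4) - 24 * ((b ^ (α + 5) - a ^ (α + 5)) / ((α + 5) * (b - a)))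
        + (b - a) ^ 2 * (α + 3) * (α + 4) * ((b ^ (α + 3) - a ^ (α + 3)) / ((α + 3) * (b - a)))
    with hE
  have hEE : 48 * ((b - a) / 2) * ((a + b) / 2) ^ (α + 4)
      - 24 * ((b ^ (α + 5) - a ^ (α + 5)) / (α + 5))
      + 4 * ((b - a) / 2) ^ 2 * ((α + 4) * (b ^ (α + 3) - a ^ (α + 3))) = (b - a) * E := by
    rw [hE]
    generalize ((a + b) / 2) ^ (α + 4) = X
    have : α + 5 ≠ 0 := by positivity
    have : α + 3 ≠ 0 := by positivity
    have := hd.ne'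
    field_simp
    ring
  rw [hEE] at key
  obtain ⟨k1, k2⟩ := key
  have hE0 : 0 ≤ E := nonneg_of_mul_nonneg_right k1 hd
  rw [abs_of_nonneg hE0]
  have hR : 0 ≤ ((b - a) ^ 3 / 8) * (α + 2) * (α + 3) * (α + 4) * b ^ (α + 1) := by positivity
  refine le_of_mul_le_mul_left (k2.trans ?_) hd
  have := mul_nonneg hd.le hR
  linarith
end

section
/- Let f : I° ⊆ ℝ → ℝ be differentiable on an open interval I°, with a, b ∈ I° and a < b, and suppose f′ is integrable on [a,b]. If |f′| is quasi-convex on [a,b], then |(f(a)+f(b))/2 − (1/(b−a)) ∫ₐᵇ f(x) dx| ≤ ((b−a)/4) · max{|f′(a)|, |f′(b)|}. -/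
open MeasureTheory intervalIntegral Set

theorem trapezoid_first_deriv_quasiconvex
    (I : Set ℝ) (hIopen : IsOpen I) (hI : I.OrdConnected)
    (f f1 : ℝ → ℝ) (a b : ℝ)
    (ha : a ∈ I) (hb : b ∈ I) (hab : a < b)
    (hf1 : ∀ x ∈ I, HasDerivAt f (f1 x) x)
    (hint : IntervalIntegrable f1 volume a b)
    (hqc : ∀ x ∈ Icc a b, ∀ y ∈ Icc a b, ∀ t ∈ Icc (0:ℝ) 1,
      |f1 (t * x + (1 - t) * y)| ≤ max |f1 x| |f1 y|) :
    |(f a + f b) / 2 - (1 / (b - a)) * ∫ x in a..b, f x|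
      ≤ ((b - a) / 4) * max |f1 a| |f1 b| := by
  have hba : 0 < b - a := sub_pos.mpr hab
  set M := max |f1 a| |f1 b| with hM
  have hbound : ∀ x ∈ Icc a b, |f1 x| ≤ M := by
    intro x hx
    have h := hqc a ⟨le_rfl, hab.le⟩ b ⟨hab.le, le_rfl⟩ ((b - x) / (b - a))
      ⟨div_nonneg (by linarith [hx.2]) hba.le, (div_le_one hba).mpr (by linarith [hx.1])⟩
    have e : (b - x) / (b - a) * a + (1 - (b - x) / (b - a)) * b = x := by
      field_simp
      ring
    rwa [e] at h
  have key := integral_mul_deriv_eq_deriv_mul (a := a) (b := b)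
    (u := fun x => x - (a + b) / 2) (u' := fun _ => 1) (v := f) (v' := f1)
    (fun x _ => (hasDerivAt_id x).sub_const _)
    (fun x hx => hf1 x (hI.out ha hb (by rwa [uIcc_of_le hab.le] at hx)))
    intervalIntegrable_const hint
  simp only [one_mul] at key
  have hcont : Continuous (fun x : ℝ => |x - (a + b) / 2|) := by fun_prop
  have habs : ∫ x in a..b, |x - (a + b) / 2| = (b - a) ^ 2 / 4 := by
    rw [← integral_add_adjacent_intervals (b := (a + b) / 2)
      (hcont.intervalIntegrable _ _) (hcont.intervalIntegrable _ _)]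
    have h1 : ∫ x in a..((a + b) / 2), |x - (a + b) / 2|
        = ∫ x in a..((a + b) / 2), ((a + b) / 2 - x) := by
      apply integral_congr
      intro x hx
      rw [uIcc_of_le (by linarith)] at hx
      simp only
      rw [abs_of_nonpos (by linarith [hx.2])]
      ring
    have h2 : ∫ x in ((a + b) / 2)..b, |x - (a + b) / 2|
        = ∫ x in ((a + b) / 2)..b, (x - (a + b) / 2) := by
      apply integral_congr
      intro x hx
      rw [uIcc_of_le (by linarith)] at hx
      exact abs_of_nonneg (by linarith [hx.1])
    rw [h1, h2, intervalIntegral.integral_sub (by simp) (by simp), intervalIntegral.integral_sub (by simp) (by simp)]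
    simp only [intervalIntegral.integral_const, integral_id, smul_eq_mul]
    ring
  have hle : |∫ x in a..b, (x - (a + b) / 2) * f1 x| ≤ ∫ x in a..b, |x - (a + b) / 2| * M := by
    rw [← Real.norm_eq_abs]
    apply norm_integral_le_of_norm_le hab.le
    · refine Filter.Eventually.of_forall fun x hx => ?_
      rw [Real.norm_eq_abs, abs_mul]
      exact mul_le_mul_of_nonneg_left (hbound x ⟨hx.1.le, hx.2⟩) (abs_nonneg _)
    · exact (hcont.mul continuous_const).intervalIntegrable _ _
  rw [intervalIntegral.integral_mul_const, habs] at hle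
  have e : (f a + f b) / 2 - (1 / (b - a)) * ∫ x in a..b, f x
      = (∫ x in a..b, (x - (a + b) / 2) * f1 x) / (b - a) := by
    rw [key]
    field_simp
    ring
  rw [e, abs_div, abs_of_pos hba, div_le_iff₀ hba]
  calc _ ≤ _ := hle
    _ = _ := by ring
end

section
/- Let f : I° ⊆ ℝ → ℝ be differentiable on an open interval I°, with a, b ∈ I° and a < b, and suppose f′ is integrable on [a,b]. Let p > 1 and q = p/(p−1). If |f′|^q is quasi-convex on [a,b], then |(f(a)+f(b))/2 − (1/(b−a)) ∫ₐᵇ f(x) dx| ≤ ((b−a) / (2(p+1)^{1/p})) · (max{|f′(a)|^q, |f′(b)|^q})^{1/q}. -/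
open MeasureTheory intervalIntegral Set

theorem trapezoid_first_deriv_quasiconvex_holder
    (I : Set ℝ) (hIopen : IsOpen I) (hI : I.OrdConnected)
    (f f1 : ℝ → ℝ) (a b p q : ℝ)
    (ha : a ∈ I) (hb : b ∈ I) (hab : a < b)
    (hp : 1 < p) (hq : q = p / (p - 1))
    (hf1 : ∀ x ∈ I, HasDerivAt f (f1 x) x)
    (hint : IntervalIntegrable f1 volume a b)
    (hqc : ∀ x ∈ Icc a b, ∀ y ∈ Icc a b, ∀ t ∈ Icc (0:ℝ) 1,
      |f1 (t * x + (1 - t) * y)| ^ q ≤ max (|f1 x| ^ q) (|f1 y| ^ q)) :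
    |(f a + f b) / 2 - (1 / (b - a)) * ∫ x in a..b, f x|
      ≤ ((b - a) / (2 * (p + 1) ^ (1 / p))) *
          (max (|f1 a| ^ q) (|f1 b| ^ q)) ^ (1 / q) := by
  have hsub : Icc a b ⊆ I := hI.out ha hb
  have hq0 : 0 < q := by rw [hq]; exact div_pos (by linarith) (by linarith)
  set M : ℝ := (max (|f1 a| ^ q) (|f1 b| ^ q)) ^ (1 / q) with hM
  have hmax0 : 0 ≤ max (|f1 a| ^ q) (|f1 b| ^ q) :=
    le_max_of_le_left (Real.rpow_nonneg (abs_nonneg _) _)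
  have hM0 : 0 ≤ M := Real.rpow_nonneg hmax0 _
  have hbd : ∀ x ∈ Icc a b, |f1 x| ≤ M := by
    intro x hx
    have hba : 0 < b - a := by linarith
    have h := hqc a (left_mem_Icc.2 hab.le) b (right_mem_Icc.2 hab.le) ((b - x) / (b - a))
      ⟨div_nonneg (by linarith [hx.2]) hba.le, (div_le_one hba).2 (by linarith [hx.1])⟩
    have e : (b - x) / (b - a) * a + (1 - (b - x) / (b - a)) * b = x := by
      field_simp
      ring
    rw [e] at h
    have h2 := Real.rpow_le_rpow (Real.rpow_nonneg (abs_nonneg _) _) h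
      (one_div_nonneg.2 hq0.le)
    rwa [one_div, Real.rpow_rpow_inv (abs_nonneg _) hq0.ne', ← one_div] at h2
  have hibp : ∫ x in a..b, (x - (a + b) / 2) * f1 x
      = (b - (a + b) / 2) * f b - (a - (a + b) / 2) * f a - ∫ x in a..b, (1 : ℝ) * f x := by
    apply intervalIntegral.integral_mul_deriv_eq_deriv_mul (u := fun x => x - (a + b) / 2)
      (u' := fun _ => (1 : ℝ))
    · intro x _
      exact (hasDerivAt_id x).sub_const _
    · intro x hx
      rw [uIcc_of_le hab.le] at hx
      exact hf1 x (hsub hx)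
    · exact intervalIntegrable_const
    · exact hint
  have habs : ∫ x in a..b, M * |x - (a + b) / 2| = M * ((b - a) ^ 2 / 4) := by
    rw [intervalIntegral.integral_const_mul]
    congr 1
    have hc : Continuous fun x : ℝ => |x - (a + b) / 2| := by fun_prop
    rw [← intervalIntegral.integral_add_adjacent_intervals (b := (a + b) / 2)
      (hc.intervalIntegrable _ _) (hc.intervalIntegrable _ _)]
    have h1 : ∫ x in a..(a + b) / 2, |x - (a + b) / 2|
        = ∫ x in a..(a + b) / 2, ((a + b) / 2 - x) := by
      apply intervalIntegral.integral_congr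
      intro x hx
      rw [uIcc_of_le (by linarith)] at hx
      simp only
      rw [abs_of_nonpos (by linarith [hx.2])]
      ring
    have h2 : ∫ x in (a + b) / 2..b, |x - (a + b) / 2|
        = ∫ x in (a + b) / 2..b, (x - (a + b) / 2) := by
      apply intervalIntegral.integral_congr
      intro x hx
      rw [uIcc_of_le (by linarith)] at hx
      exact abs_of_nonneg (by linarith [hx.1])
    rw [h1, h2, intervalIntegral.integral_sub (by simp) (by simp),
      intervalIntegral.integral_sub (by simp) (by simp)]
    simp only [integral_id, intervalIntegral.integral_const, smul_eq_mul]
    ring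
  have hle : ‖∫ x in a..b, (x - (a + b) / 2) * f1 x‖
      ≤ ∫ x in a..b, M * |x - (a + b) / 2| := by
    apply intervalIntegral.norm_integral_le_of_norm_le hab.le
    · refine Filter.Eventually.of_forall fun x hx => ?_
      rw [Real.norm_eq_abs, abs_mul, mul_comm]
      exact mul_le_mul_of_nonneg_right (hbd x ⟨hx.1.le, hx.2⟩) (abs_nonneg _)
    · apply Continuous.intervalIntegrable
      fun_prop
  rw [habs, hibp, Real.norm_eq_abs] at hle
  simp only [one_mul] at hle
  have hba : 0 < b - a := by linarith
  have e : (f a + f b) / 2 - (1 / (b - a)) * ∫ x in a..b, f x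
      = ((b - (a + b) / 2) * f b - (a - (a + b) / 2) * f a - ∫ x in a..b, f x) / (b - a) := by
    field_simp
    ring
  rw [e, abs_div, abs_of_pos hba, div_le_iff₀ hba]
  refine hle.trans ?_
  have hp0 : 0 < p := by linarith
  have hC0 : 0 < (p + 1) ^ (1 / p) := Real.rpow_pos_of_pos (by linarith) _
  have hC : (p + 1) ^ (1 / p) ≤ 2 := by
    have h := one_add_mul_self_le_rpow_one_add (s := 1) (by norm_num) hp.le
    have h' : p + 1 ≤ (2 : ℝ) ^ p := by
      norm_num at h
      linarith
    have h2 := Real.rpow_le_rpow (by linarith) h' (one_div_nonneg.2 hp0.le)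
    rw [one_div, Real.rpow_rpow_inv (by norm_num) hp0.ne', ← one_div] at h2
    exact h2
  have h4 : (b - a) / 4 ≤ (b - a) / (2 * (p + 1) ^ (1 / p)) :=
    div_le_div_of_nonneg_left hba.le (by linarith) (by linarith)
  have h5 := mul_le_mul_of_nonneg_right h4 (mul_nonneg hM0 hba.le)
  nlinarith [h5]
end

section
/- Let f : I° ⊆ ℝ → ℝ be twice differentiable on an open interval I°, with a, b ∈ I° and a < b, and suppose f″ is integrable on [a,b]. If |f″| is quasi-convex on [a,b], then |(f(a)+f(b))/2 − (1/(b−a)) ∫ₐᵇ f(x) dx| ≤ ((b−a)²/12) · max{|f″(a)|, |f″(b)|}. -/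
open MeasureTheory intervalIntegral Set

theorem trapezoid_second_deriv_quasiconvex
    (I : Set ℝ) (hIopen : IsOpen I) (hI : I.OrdConnected)
    (f f1 f2 : ℝ → ℝ) (a b : ℝ)
    (ha : a ∈ I) (hb : b ∈ I) (hab : a < b)
    (hf1 : ∀ x ∈ I, HasDerivAt f (f1 x) x)
    (hf2 : ∀ x ∈ I, HasDerivAt f1 (f2 x) x)
    (hint : IntervalIntegrable f2 volume a b)
    (hqc : ∀ x ∈ Icc a b, ∀ y ∈ Icc a b, ∀ t ∈ Icc (0:ℝ) 1,
      |f2 (t * x + (1 - t) * y)| ≤ max |f2 x| |f2 y|) :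
    |(f a + f b) / 2 - (1 / (b - a)) * ∫ x in a..b, f x|
      ≤ ((b - a) ^ 2 / 12) * max |f2 a| |f2 b| := by
  have hsub : ∀ x ∈ Icc a b, x ∈ I := fun x hx => hI.out ha hb hx
  have hu : uIcc a b = Icc a b := uIcc_of_le hab.le
  set M := max |f2 a| |f2 b| with hM
  have hbd : ∀ x ∈ Icc a b, |f2 x| ≤ M := by
    intro x hx
    have hpos : 0 < b - a := sub_pos.2 hab
    have h := hqc a ⟨le_rfl, hab.le⟩ b ⟨hab.le, le_rfl⟩ ((b - x) / (b - a))
      ⟨div_nonneg (by linarith [hx.2]) hpos.le, by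
        rw [div_le_one hpos]; linarith [hx.1]⟩
    have e : (b - x) / (b - a) * a + (1 - (b - x) / (b - a)) * b = x := by
      field_simp
      ring
    rwa [e] at h
  have hwc : Continuous (fun x : ℝ => (x - a) * (b - x)) := by fun_prop
  have hfi : IntervalIntegrable f volume a b := by
    apply ContinuousOn.intervalIntegrable
    rw [hu]
    exact fun x hx => (hf1 x (hsub x hx)).continuousAt.continuousWithinAt
  have hwi : IntervalIntegrable (fun x => (x - a) * (b - x) * f2 x) volume a b :=
    hint.continuousOn_mul hwc.continuousOn
  have h2i : IntervalIntegrable (fun x => 2 * f x) volume a b := hfi.const_mul 2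
  have hw : ∀ x : ℝ, HasDerivAt (fun x : ℝ => (x - a) * (b - x)) (a + b - 2 * x) x := by
    intro x
    have h := ((hasDerivAt_id x).sub_const a).mul ((hasDerivAt_id x).const_sub b)
    refine h.congr_deriv ?_
    simp only [id]
    ring
  have hw2 : ∀ x : ℝ, HasDerivAt (fun x : ℝ => a + b - 2 * x) (-2) x := by
    intro x
    have h := ((hasDerivAt_id x).const_mul 2).const_sub (a + b)
    refine h.congr_deriv ?_
    ring
  have key := integral_eq_sub_of_hasDerivAt
    (f := fun x => (x - a) * (b - x) * f1 x - (a + b - 2 * x) * f x)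
    (f' := fun x => (x - a) * (b - x) * f2 x + 2 * f x) (a := a) (b := b)
    (by
      intro x hx
      rw [hu] at hx
      have h := ((hw x).mul (hf2 x (hsub x hx))).sub ((hw2 x).mul (hf1 x (hsub x hx)))
      refine h.congr_deriv ?_
      ring) (hwi.add h2i)
  rw [integral_add hwi h2i, intervalIntegral.integral_const_mul] at key
  have key2 := integral_eq_sub_of_hasDerivAt
    (f := fun x => (b - a) * (x - a) ^ 2 / 2 * M - (x - a) ^ 3 / 3 * M)
    (f' := fun x => (x - a) * (b - x) * M) (a := a) (b := b)
    (by
      intro x hx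
      have h0 := (hasDerivAt_id x).sub_const a
      have h := ((((h0.pow 2).const_mul (b - a)).div_const 2).mul_const M).sub
        (((h0.pow 3).div_const 3).mul_const M)
      refine h.congr_deriv ?_
      simp only [id]
      push_cast
      ring) ((hwc.mul continuous_const).intervalIntegrable _ _)
  have hle := norm_integral_le_of_norm_le (μ := volume) (f := fun x => (x - a) * (b - x) * f2 x)
    (g := fun x => (x - a) * (b - x) * M) hab.le
    (Filter.Eventually.of_forall (by
      intro x hx
      have hn : 0 ≤ (x - a) * (b - x) := mul_nonneg (by linarith [hx.1]) (by linarith [hx.2])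
      rw [Real.norm_eq_abs, abs_mul, abs_of_nonneg hn]
      exact mul_le_mul_of_nonneg_left (hbd x ⟨hx.1.le, hx.2⟩) hn))
    ((hwc.mul continuous_const).intervalIntegrable _ _)
  rw [key2, Real.norm_eq_abs] at hle
  have hpos : 0 < b - a := sub_pos.2 hab
  have e : (f a + f b) / 2 - (1 / (b - a)) * ∫ x in a..b, f x
      = (∫ x in a..b, (x - a) * (b - x) * f2 x) / (2 * (b - a)) := by
    rw [eq_sub_of_add_eq key]
    field_simp
    ring
  rw [e, abs_div, abs_of_pos (by positivity : 0 < 2 * (b - a)), div_le_iff₀ (by positivity)]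
  refine hle.trans (le_of_eq ?_)
  ring
end
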